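/- Let n be odd and let p : ZMod n → ℝ² be any n points in the plane. Then there exists exactly one closed polygonal curve q : ZMod n → ℝ² satisfying the midpoint property with respect to p, namely the one with q_0 = Σ_{k=1}^{n} (−1)^{n−k} p_k (the alternating sum of p_1, …, p_n taken over representatives 1, …, n). -/

import Mathlib

noncomputable section

/-- The plane. -/
abbrev E2 := EuclideanSpace ℝ (Fin 2)

/-- A closed polygonal curve `q : ZMod n → E2` satisfies the midpoint property with
respect to `p : ZMod n → E2` if `p k` is the midpoint of `q (k-1)` and `q k` for all `k`. -/
def MidpointProperty (n : ℕ) (p q : ZMod n → E2) : Prop :=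
  ∀ k : ZMod n, p k = midpoint ℝ (q (k - 1)) (q k)

theorem sum_range_neg_one_pow_smul_add_succ {E : Type*} [AddCommGroup E] [Module ℝ E]
    (f : ℕ → E) (m : ℕ) :
    ∑ i ∈ Finset.range m, (-1 : ℝ) ^ i • (f i + f (i + 1)) = f 0 - (-1 : ℝ) ^ m • f m := by
  induction m with
  | zero => simp
  | succ m ih =>
    rw [Finset.sum_range_succ, ih, pow_succ]
    module

/-- The alternating sum of `p j, p (j - 1), …, p (j - (n - 1))`. -/
def alternatingCurve (n : ℕ) (p : ZMod n → E2) (j : ZMod n) : E2 :=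
  ∑ i ∈ Finset.range n, (-1 : ℝ) ^ i • p (j - (i : ZMod n))

theorem midpointProperty_iff_two_smul {n : ℕ} {p q : ZMod n → E2} :
    MidpointProperty n p q ↔ ∀ k, q k + q (k - 1) = (2 : ℝ) • p k := by
  refine forall_congr' fun k => ?_
  rw [midpoint_eq_smul_add, invOf_eq_inv, eq_inv_smul_iff₀ two_ne_zero, add_comm, eq_comm]

theorem midpointProperty_alternatingCurve {n : ℕ} (hn : Odd n) (p : ZMod n → E2) :
    MidpointProperty n p (alternatingCurve n p) := by
  refine midpointProperty_iff_two_smul.2 fun k => ?_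
  have h := sum_range_neg_one_pow_smul_add_succ (fun i : ℕ => p (k - (i : ZMod n))) n
  simp only [smul_add, Finset.sum_add_distrib, Nat.cast_add, Nat.cast_one, Nat.cast_zero,
    sub_zero, ZMod.natCast_self, hn.neg_one_pow] at h
  simp only [alternatingCurve, sub_sub, add_comm (1 : ZMod n)]
  rw [h]
  module

theorem MidpointProperty.eq_alternatingCurve {n : ℕ} (hn : Odd n) {p q : ZMod n → E2}
    (hq : MidpointProperty n p q) : q = alternatingCurve n p := by
  funext j
  have h := sum_range_neg_one_pow_smul_add_succ (fun i : ℕ => q (j - (i : ZMod n))) n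
  simp only [Nat.cast_add, Nat.cast_one, Nat.cast_zero, sub_zero, ZMod.natCast_self,
    hn.neg_one_pow, ← sub_sub, midpointProperty_iff_two_smul.1 hq, smul_comm _ (2 : ℝ),
    ← Finset.smul_sum] at h
  refine smul_right_injective E2 (two_ne_zero (α := ℝ)) ?_
  change (2 : ℝ) • q j = (2 : ℝ) • alternatingCurve n p j
  rw [alternatingCurve, h]
  module

theorem alternatingCurve_zero (n : ℕ) (p : ZMod n → E2) :
    alternatingCurve n p 0 =
      ∑ k ∈ Finset.Icc 1 n, (-1 : ℝ) ^ (n - k) • p (k : ZMod n) := by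
  refine Finset.sum_bij' (fun i _ => n - i) (fun k _ => n - k) ?_ ?_ ?_ ?_ ?_ <;>
    simp only [Finset.mem_range, Finset.mem_Icc] <;> intro i hi
  · omega
  · omega
  · omega
  · omega
  · rw [Nat.sub_sub_self hi.le, Nat.cast_sub hi.le, ZMod.natCast_self]

theorem stmt1 (n : ℕ) (hn : Odd n) (p : ZMod n → E2) :
    (∃! q : ZMod n → E2, MidpointProperty n p q) ∧
    (∀ q : ZMod n → E2, MidpointProperty n p q →
      q 0 = ∑ k ∈ Finset.Icc 1 n, ((-1 : ℝ)) ^ (n - k) • p (k : ZMod n)) := by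
  refine ⟨⟨alternatingCurve n p, midpointProperty_alternatingCurve hn p,
    fun q hq => hq.eq_alternatingCurve hn⟩, fun q hq => ?_⟩
  rw [hq.eq_alternatingCurve hn, alternatingCurve_zero]
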